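/- Let (ψ, (P_x^a), (Q_y^b)) be any finite-dimensional strategy inducing the ideal correlation p*. Then: (i) (P_0^0⊗I)ψ = (I⊗Q_4^0)ψ = ((P_2^2 + P_2^0)⊗I)ψ; (ii) (P_0^1⊗I)ψ = (I⊗Q_4^1)ψ = (P_2^1⊗I)ψ; and (iii) ψ = (P_0^0⊗Q_4^0)ψ + (P_0^1⊗Q_4^1)ψ. -/

import Mathlib

open Matrix Kronecker

noncomputable section

namespace Sep

/-- Pauli `σz`. -/
def sz : Matrix (Fin 2) (Fin 2) ℝ := !![1, 0; 0, -1]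

/-- Pauli `σx`. -/
def sx : Matrix (Fin 2) (Fin 2) ℝ := !![0, 1; 1, 0]

/-- `μ = arctan (sin 2θ)` where `θ = arctan α`. -/
def mu (α : ℝ) : ℝ := Real.arctan (Real.sin (2 * Real.arctan α))

/-- The tilted Pauli `σαz`. -/
def saz (α : ℝ) : Matrix (Fin 2) (Fin 2) ℝ :=
  Real.cos (mu α) • sz + Real.sin (mu α) • sx

/-- The tilted Pauli `σαx`. -/
def sax (α : ℝ) : Matrix (Fin 2) (Fin 2) ℝ :=
  Real.cos (mu α) • sz - Real.sin (mu α) • sx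

/-- Orthogonal projection onto the `+1`-eigenspace of a symmetric involution `O`
(with eigenvalues `+1` and `-1`): `O⁺ = (I + O)/2`. -/
def pl (O : Matrix (Fin 2) (Fin 2) ℝ) : Matrix (Fin 2) (Fin 2) ℝ := (2 : ℝ)⁻¹ • (1 + O)

/-- Orthogonal projection onto the `-1`-eigenspace: `O⁻ = (I - O)/2`. -/
def mn (O : Matrix (Fin 2) (Fin 2) ℝ) : Matrix (Fin 2) (Fin 2) ℝ := (2 : ℝ)⁻¹ • (1 - O)

/-- Embed a `2×2` matrix `O` as an `ℕ×ℕ` matrix supported on rows/columns `f 0, f 1`,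
with entry `O r s` at position `(f r, f s)`. -/
def embed (f : Fin 2 → ℕ) (O : Matrix (Fin 2) (Fin 2) ℝ) : Matrix ℕ ℕ ℝ :=
  fun i j => ∑ r : Fin 2, ∑ s : Fin 2, if i = f r ∧ j = f s then O r s else 0

/-- `ev_m(O)`: supported on `{2m, 2m+1}`. -/
def evm (m : ℕ) (O : Matrix (Fin 2) (Fin 2) ℝ) : Matrix ℕ ℕ ℝ :=
  embed (fun r => 2 * m + (r : ℕ)) O

/-- `od_m(O)`: supported on `{2m+1, 2m+2}`. -/
def odm (m : ℕ) (O : Matrix (Fin 2) (Fin 2) ℝ) : Matrix ℕ ℕ ℝ :=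
  embed (fun r => 2 * m + 1 + (r : ℕ)) O

/-- Entrywise sum `Σ_m F m` of a family of `ℕ×ℕ` matrices. -/
def sumB (F : ℕ → Matrix ℕ ℕ ℝ) : Matrix ℕ ℕ ℝ := fun i j => ∑' m, F m i j

/-- The `ℕ×ℕ` matrix with a single `1` entry at `(0,0)`. -/
def E00 : Matrix ℕ ℕ ℝ := fun i j => if i = 0 ∧ j = 0 then 1 else 0

/-- Alice's ideal operators `A_x^a`. -/
def Aop : Fin 4 → Fin 3 → Matrix ℕ ℕ ℝ :=
  ![![sumB (fun m => evm m (pl sz)), sumB (fun m => evm m (mn sz)), 0],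
    ![sumB (fun m => evm m (pl sx)), sumB (fun m => evm m (mn sx)), 0],
    ![sumB (fun m => odm m (mn sz)), sumB (fun m => odm m (pl sz)), E00],
    ![sumB (fun m => odm m (mn sx)), sumB (fun m => odm m (pl sx)), E00]]

/-- Bob's ideal operators `B_y^b`. -/
def Bop (α : ℝ) : Fin 5 → Fin 3 → Matrix ℕ ℕ ℝ :=
  ![![sumB (fun m => evm m (pl (saz α))), sumB (fun m => evm m (mn (saz α))), 0],
    ![sumB (fun m => evm m (pl (sax α))), sumB (fun m => evm m (mn (sax α))), 0],
    ![sumB (fun m => odm m (mn (saz α))), sumB (fun m => odm m (pl (saz α))), E00],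
    ![sumB (fun m => odm m (mn (sax α))), sumB (fun m => odm m (pl (sax α))), E00],
    ![Aop 0 0, Aop 0 1, Aop 0 2]]

/-- The ideal correlation `p*(a,b|x,y) = (1-α²) Σ_{i,k} α^{i+k} A_x^a(i,k) B_y^b(i,k)`. -/
def pstar (α : ℝ) (x : Fin 4) (y : Fin 5) (a b : Fin 3) : ℝ :=
  (1 - α ^ 2) * ∑' ik : ℕ × ℕ, α ^ (ik.1 + ik.2) * Aop x a ik.1 ik.2 * Bop α y b ik.1 ik.2

/-- A finite-dimensional strategy on question sets `Fin 4`, `Fin 5` and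
answer sets `Fin 3`, `Fin 3`. -/
structure Strategy (dA dB : ℕ) where
  ψ : Fin dA × Fin dB → ℂ
  P : Fin 4 → Fin 3 → Matrix (Fin dA) (Fin dA) ℂ
  Q : Fin 5 → Fin 3 → Matrix (Fin dB) (Fin dB) ℂ
  unit : ∑ p : Fin dA × Fin dB, Complex.normSq (ψ p) = 1
  P_sa : ∀ x a, (P x a)ᴴ = P x a
  P_proj : ∀ x a, P x a * P x a = P x a
  P_complete : ∀ x, ∑ a, P x a = 1
  Q_sa : ∀ y b, (Q y b)ᴴ = Q y b
  Q_proj : ∀ y b, Q y b * Q y b = Q y b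
  Q_complete : ∀ y, ∑ b, Q y b = 1

/-- Action of `P ⊗ I` on a bipartite vector. -/
def actA {dA dB : ℕ} (P : Matrix (Fin dA) (Fin dA) ℂ) (ψ : Fin dA × Fin dB → ℂ) :
    Fin dA × Fin dB → ℂ := fun p => ∑ k, P p.1 k * ψ (k, p.2)

/-- Action of `I ⊗ Q` on a bipartite vector. -/
def actB {dA dB : ℕ} (Q : Matrix (Fin dB) (Fin dB) ℂ) (ψ : Fin dA × Fin dB → ℂ) :
    Fin dA × Fin dB → ℂ := fun p => ∑ l, Q p.2 l * ψ (p.1, l)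

/-- The correlation induced by a strategy: `⟨ψ, (P_x^a ⊗ Q_y^b) ψ⟩`. -/
def induced {dA dB : ℕ} (S : Strategy dA dB) (x : Fin 4) (y : Fin 5) (a b : Fin 3) : ℂ :=
  ∑ p : Fin dA × Fin dB, (starRingEnd ℂ) (S.ψ p) * actA (S.P x a) (actB (S.Q y b) S.ψ) p

end Sep

namespace Sep

section Action

variable {dA dB : ℕ}

lemma actA_actB_eq_kronecker_mulVec (P : Matrix (Fin dA) (Fin dA) ℂ)
    (Q : Matrix (Fin dB) (Fin dB) ℂ) (ψ : Fin dA × Fin dB → ℂ) :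
    actA P (actB Q ψ) = (P ⊗ₖ Q) *ᵥ ψ := by
  ext p
  simp only [actA, actB, Matrix.mulVec, dotProduct, Matrix.kroneckerMap_apply,
    Fintype.sum_prod_type, Finset.mul_sum, mul_assoc]

lemma actA_eq_kronecker_mulVec (P : Matrix (Fin dA) (Fin dA) ℂ) (ψ : Fin dA × Fin dB → ℂ) :
    actA P ψ = (P ⊗ₖ (1 : Matrix (Fin dB) (Fin dB) ℂ)) *ᵥ ψ := by
  rw [← actA_actB_eq_kronecker_mulVec]
  congr 1
  ext p
  simp [actB, Matrix.one_apply]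

lemma actB_eq_kronecker_mulVec (Q : Matrix (Fin dB) (Fin dB) ℂ) (ψ : Fin dA × Fin dB → ℂ) :
    actB Q ψ = ((1 : Matrix (Fin dA) (Fin dA) ℂ) ⊗ₖ Q) *ᵥ ψ := by
  rw [← actA_actB_eq_kronecker_mulVec]
  ext p
  simp [actA, Matrix.one_apply]

open scoped ComplexOrder in
/-- A vector with zero expectation under an orthogonal projection is annihilated by it. -/
lemma mulVec_eq_zero_of_expectation_eq_zero {n : Type*} [Fintype n] {M : Matrix n n ℂ}
    (hsa : Mᴴ = M) (hproj : M * M = M) {v : n → ℂ} (h : star v ⬝ᵥ (M *ᵥ v) = 0) :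
    M *ᵥ v = 0 := by
  rw [← dotProduct_star_self_eq_zero, Matrix.star_mulVec,
    ← Matrix.dotProduct_mulVec, Matrix.mulVec_mulVec, hsa, hproj, h]

/-- An answer pair of probability zero has a joint projection that annihilates the state. -/
lemma kronecker_mulVec_eq_zero_of_induced_eq_zero (S : Strategy dA dB) {x : Fin 4} {y : Fin 5}
    {a b : Fin 3} (h : induced S x y a b = 0) : (S.P x a ⊗ₖ S.Q y b) *ᵥ S.ψ = 0 := by
  refine mulVec_eq_zero_of_expectation_eq_zero ?_ ?_ ?_
  · rw [Matrix.conjTranspose_kronecker, S.P_sa, S.Q_sa]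
  · rw [← Matrix.mul_kronecker_mul, S.P_proj, S.Q_proj]
  · rw [← actA_actB_eq_kronecker_mulVec]
    exact h

/-- Decomposition of `(P_x^a ⊗ I)ψ` along the outcomes of a question to Bob. -/
lemma actA_eq_sum_kronecker_mulVec (S : Strategy dA dB) (x : Fin 4) (a : Fin 3) (y : Fin 5) :
    actA (S.P x a) S.ψ = ∑ b, (S.P x a ⊗ₖ S.Q y b) *ᵥ S.ψ := by
  rw [actA_eq_kronecker_mulVec, ← S.Q_complete y]
  simp only [Fin.sum_univ_three, Matrix.kronecker_add, Matrix.add_mulVec]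

/-- Decomposition of `(I ⊗ Q_y^b)ψ` along the outcomes of a question to Alice. -/
lemma actB_eq_sum_kronecker_mulVec (S : Strategy dA dB) (y : Fin 5) (b : Fin 3) (x : Fin 4) :
    actB (S.Q y b) S.ψ = ∑ a, (S.P x a ⊗ₖ S.Q y b) *ᵥ S.ψ := by
  rw [actB_eq_kronecker_mulVec, ← S.P_complete x]
  simp only [Fin.sum_univ_three, Matrix.add_kronecker, Matrix.add_mulVec]

/-- Decomposition of `ψ` along the outcomes of a question to Bob. -/
lemma sum_actB_eq (S : Strategy dA dB) (y : Fin 5) : ∑ b, actB (S.Q y b) S.ψ = S.ψ := by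
  simp only [actB_eq_kronecker_mulVec]
  rw [← Matrix.sum_mulVec]
  simp only [Fin.sum_univ_three, ← Matrix.kronecker_add]
  rw [← Fin.sum_univ_three (S.Q y), S.Q_complete, Matrix.one_kronecker_one, Matrix.one_mulVec]

lemma actA_add (P P' : Matrix (Fin dA) (Fin dA) ℂ) (ψ : Fin dA × Fin dB → ℂ) :
    actA (P + P') ψ = actA P ψ + actA P' ψ := by
  simp only [actA_eq_kronecker_mulVec, Matrix.add_kronecker, Matrix.add_mulVec]

end Action

section Support

lemma pl_sz : pl sz = !![1, 0; 0, 0] := by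
  ext i j
  fin_cases i <;> fin_cases j <;> norm_num [pl, sz]

lemma mn_sz : mn sz = !![0, 0; 0, 1] := by
  ext i j
  fin_cases i <;> fin_cases j <;> norm_num [mn, sz]

lemma sumB_apply_eq_zero {F : ℕ → Matrix ℕ ℕ ℝ} {i j : ℕ} (h : ∀ m, F m i j = 0) :
    sumB F i j = 0 := by
  simp [sumB, h]

lemma sumB_evm_pl_sz_apply_eq_zero {i : ℕ} (hi : i % 2 = 1) (j : ℕ) :
    sumB (fun m => evm m (pl sz)) i j = 0 := by
  refine sumB_apply_eq_zero fun m => ?_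
  have : i ≠ 2 * m := by omega
  simp [evm, embed, pl_sz, this]

lemma sumB_evm_mn_sz_apply_eq_zero {i : ℕ} (hi : i % 2 = 0) (j : ℕ) :
    sumB (fun m => evm m (mn sz)) i j = 0 := by
  refine sumB_apply_eq_zero fun m => ?_
  have : i ≠ 2 * m + 1 := by omega
  simp [evm, embed, mn_sz, this]

lemma sumB_odm_mn_sz_apply_eq_zero {i : ℕ} (hi : i % 2 = 1) (j : ℕ) :
    sumB (fun m => odm m (mn sz)) i j = 0 := by
  refine sumB_apply_eq_zero fun m => ?_
  have : i ≠ 2 * m + 1 + 1 := by omega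
  simp [odm, embed, mn_sz, this]

lemma sumB_odm_pl_sz_apply_eq_zero {i : ℕ} (hi : i % 2 = 0) (j : ℕ) :
    sumB (fun m => odm m (pl sz)) i j = 0 := by
  refine sumB_apply_eq_zero fun m => ?_
  have : i ≠ 2 * m + 1 := by omega
  simp [odm, embed, pl_sz, this]

lemma E00_apply_eq_zero {i : ℕ} (hi : i % 2 = 1) (j : ℕ) : E00 i j = 0 := by
  have : i ≠ 0 := by omega
  simp [E00, this]

lemma pstar_eq_zero {α : ℝ} {x : Fin 4} {y : Fin 5} {a b : Fin 3}
    (h : ∀ i k, Aop x a i k = 0 ∨ Bop α y b i k = 0) : pstar α x y a b = 0 := by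
  have h0 : ∀ ik : ℕ × ℕ,
      α ^ (ik.1 + ik.2) * Aop x a ik.1 ik.2 * Bop α y b ik.1 ik.2 = 0 := fun ik => by
    rcases h ik.1 ik.2 with h | h <;> simp [h]
  simp [pstar, h0]

lemma pstar_four_two_eq_zero (α : ℝ) (x : Fin 4) (a : Fin 3) : pstar α x 4 a 2 = 0 :=
  pstar_eq_zero fun _ _ => Or.inr rfl

lemma pstar_four_zero_eq_zero {α : ℝ} {x : Fin 4} {a : Fin 3}
    (h : ∀ i j, i % 2 = 0 → Aop x a i j = 0) : pstar α x 4 a 0 = 0 :=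
  pstar_eq_zero fun i k => (Nat.mod_two_eq_zero_or_one i).imp (h i k)
    fun hi => sumB_evm_pl_sz_apply_eq_zero hi k

lemma pstar_four_one_eq_zero {α : ℝ} {x : Fin 4} {a : Fin 3}
    (h : ∀ i j, i % 2 = 1 → Aop x a i j = 0) : pstar α x 4 a 1 = 0 :=
  pstar_eq_zero fun i k => (Nat.mod_two_eq_zero_or_one i).symm.imp (h i k)
    fun hi => sumB_evm_mn_sz_apply_eq_zero hi k

end Support

end Sep

open Sep in
/-- for any finite-dimensional strategy inducing `p*`:
(i) `(P_0^0⊗I)ψ = (I⊗Q_4^0)ψ = ((P_2^2+P_2^0)⊗I)ψ`;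
(ii) `(P_0^1⊗I)ψ = (I⊗Q_4^1)ψ = (P_2^1⊗I)ψ`;
(iii) `ψ = (P_0^0⊗Q_4^0)ψ + (P_0^1⊗Q_4^1)ψ`. -/
theorem projector_relations_from_question_four
    (α : ℝ) (hα0 : 0 < α) (hα1 : α < 1)
    {dA dB : ℕ} (hdA : 1 ≤ dA) (hdB : 1 ≤ dB) (S : Strategy dA dB)
    (hind : ∀ x y a b, induced S x y a b = (pstar α x y a b : ℂ)) :
    (actA (S.P 0 0) S.ψ = actB (S.Q 4 0) S.ψ ∧
      actA (S.P 0 0) S.ψ = actA (S.P 2 2 + S.P 2 0) S.ψ) ∧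
    (actA (S.P 0 1) S.ψ = actB (S.Q 4 1) S.ψ ∧
      actA (S.P 0 1) S.ψ = actA (S.P 2 1) S.ψ) ∧
    S.ψ = actA (S.P 0 0) (actB (S.Q 4 0) S.ψ) + actA (S.P 0 1) (actB (S.Q 4 1) S.ψ) := by
  have hz : ∀ x a b, pstar α x 4 a b = 0 → (S.P x a ⊗ₖ S.Q 4 b) *ᵥ S.ψ = 0 := fun x a b h =>
    kronecker_mulVec_eq_zero_of_induced_eq_zero S (by rw [hind, h, Complex.ofReal_zero])
  have hx2 : ∀ x a, (S.P x a ⊗ₖ S.Q 4 2) *ᵥ S.ψ = 0 := fun x a =>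
    hz x a 2 (pstar_four_two_eq_zero α x a)
  have h01 := hz 0 0 1 (pstar_four_one_eq_zero fun _ j hi => sumB_evm_pl_sz_apply_eq_zero hi j)
  have h10 := hz 0 1 0 (pstar_four_zero_eq_zero fun _ j hi => sumB_evm_mn_sz_apply_eq_zero hi j)
  have h20 := hz 0 2 0 (pstar_four_zero_eq_zero fun _ _ _ => rfl)
  have h21 := hz 0 2 1 (pstar_four_one_eq_zero fun _ _ _ => rfl)
  have k01 := hz 2 0 1 (pstar_four_one_eq_zero fun _ j hi => sumB_odm_mn_sz_apply_eq_zero hi j)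
  have k10 := hz 2 1 0 (pstar_four_zero_eq_zero fun _ j hi => sumB_odm_pl_sz_apply_eq_zero hi j)
  have k21 := hz 2 2 1 (pstar_four_one_eq_zero fun _ j hi => E00_apply_eq_zero hi j)
  have hP0 := actA_eq_sum_kronecker_mulVec S 0 0 4
  have hP1 := actA_eq_sum_kronecker_mulVec S 0 1 4
  have hR0 := actA_eq_sum_kronecker_mulVec S 2 0 4
  have hR1 := actA_eq_sum_kronecker_mulVec S 2 1 4
  have hR2 := actA_eq_sum_kronecker_mulVec S 2 2 4
  have hQ0 := actB_eq_sum_kronecker_mulVec S 4 0 0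
  have hQ1 := actB_eq_sum_kronecker_mulVec S 4 1 0
  have hQ2 := actB_eq_sum_kronecker_mulVec S 4 2 0
  have hQ0' := actB_eq_sum_kronecker_mulVec S 4 0 2
  have hQ1' := actB_eq_sum_kronecker_mulVec S 4 1 2
  have hsum := sum_actB_eq S 4
  simp only [Fin.sum_univ_three, hx2, h01, h10, h20, h21, k01, k10, k21, add_zero, zero_add]
    at hP0 hP1 hR0 hR1 hR2 hQ0 hQ1 hQ2 hQ0' hQ1' hsum
  refine ⟨⟨hP0.trans hQ0.symm, ?_⟩, ⟨hP1.trans hQ1.symm, ?_⟩, ?_⟩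
  · rw [actA_add, hP0, ← hQ0, hQ0', hR2, hR0, add_comm]
  · rw [hP1, ← hQ1, hQ1', hR1]
  · rw [actA_actB_eq_kronecker_mulVec, actA_actB_eq_kronecker_mulVec, ← hQ0, ← hQ1]
    rw [hQ2, add_zero] at hsum
    exact hsum.symm
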